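/- arXiv:2108.01579 — 4 statements merged into one kernel-verified Lean document; each statement's English description precedes it below -/
import Mathlib

section
/- Let A ∈ ℝ^{n×n} and B = [I_m; 0] ∈ ℝ^{n×m}. Partition the rows [1,n] into the leader set L = [1,m] and consecutive follower blocks F₁,…,F_K of sizes m₁,…,m_K with m + m₁ + ⋯ + m_K = n, each m_k ≥ 1. Assume that for each k ∈ [1,K] the rows of A^j B indexed by F_k are zero for every j < k, and that Φ_k ∈ ℝ^{m_k×m}, the submatrix of A^k B formed by the rows indexed by F_k, has no zero rows. For each k define J_k := {j ∈ [1,m] : Φ_k e_j is unisigned} and H_k := ⋃_{j∈J_k} ZP(Φ_k e_j). If |H_k| ≥ m_k − 1 for every k ∈ [1,K], then the pair (A,B) is herdable. -/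
open Matrix

/-- A nonzero real vector is unisigned if all its nonzero entries have the same sign. -/
def Unisigned {ι : Type*} (v : ι → ℝ) : Prop :=
  v ≠ 0 ∧ ((∀ i, 0 ≤ v i) ∨ (∀ i, v i ≤ 0))

/-- The controllability matrix `[B | AB | A²B | ... | A^{n-1}B]` of the pair `(A, B)`,
where the state is indexed by a finite type `I` of cardinality `n`. -/
def ctrbMat {I : Type*} [Fintype I] [DecidableEq I] {m : ℕ} (A : Matrix I I ℝ) (B : Matrix I (Fin m) ℝ) :
    Matrix I (Fin (Fintype.card I) × Fin m) ℝ :=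
  Matrix.of fun i p => (A ^ (p.1 : ℕ) * B) i p.2

/-- The state indices: the `m` leaders followed by the follower blocks `F₁, …, F_K`
of sizes `ms 0, …, ms (K-1)`, so that `n = m + m₁ + ⋯ + m_K`. -/
abbrev LFIdx (m K : ℕ) (ms : Fin K → ℕ) := Fin m ⊕ (Σ k : Fin K, Fin (ms k))

lemma exists_forall_pos_mul_add {ι : Type*} [Finite ι] (a b : ι → ℝ) :
    ∃ t : ℝ, ∀ i, 0 < a i ∨ (0 ≤ a i ∧ 0 < b i) → 0 < t * a i + b i := by
  have h : ∀ᶠ t : ℝ in Filter.atTop,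
      ∀ i, 0 < a i ∨ (0 ≤ a i ∧ 0 < b i) → 0 < t * a i + b i := by
    rw [Filter.eventually_all]
    intro i
    filter_upwards [Filter.eventually_ge_atTop 0, Filter.eventually_gt_atTop (-b i / a i)]
      with t ht htb hi
    rcases hi with hi | ⟨h0, hb⟩
    · rw [div_lt_iff₀ hi] at htb
      linarith
    · positivity
  exact h.exists

lemma exists_mulVec_pos_of_ncard_unisigned {ι κ : Type*} [Finite ι] [Fintype κ]
    (M : Matrix ι κ ℝ) (hrows : ∀ i, ∃ c, M i c ≠ 0)
    (hcard : Nat.card ι - 1 ≤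
      Set.ncard {i : ι | ∃ c, Unisigned (fun i' => M i' c) ∧ M i c ≠ 0}) :
    ∃ v : κ → ℝ, ∀ i, 0 < (M *ᵥ v) i := by
  classical
  set H : Set ι := {i : ι | ∃ c, Unisigned (fun i' => M i' c) ∧ M i c ≠ 0} with hH
  let w : κ → ℝ := fun c =>
    if Unisigned (fun i => M i c) then (if ∀ i, 0 ≤ M i c then 1 else -1) else 0
  have hterm : ∀ i c, 0 ≤ M i c * w c := by
    intro i c
    by_cases hu : Unisigned (fun i => M i c)
    · by_cases hp : ∀ i, 0 ≤ M i c
      · simp [w, hu, hp]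
      · simpa [w, hu, hp] using hu.2.resolve_left hp i
    · simp [w, hu]
  have hnonneg : ∀ i, 0 ≤ (M *ᵥ w) i := fun i => Finset.sum_nonneg fun c _ => hterm i c
  have hpos : ∀ i ∈ H, 0 < (M *ᵥ w) i := by
    rintro i ⟨c, hu, hc⟩
    refine Finset.sum_pos' (fun c _ => hterm i c) ⟨c, Finset.mem_univ c, ?_⟩
    refine lt_of_le_of_ne (hterm i c) (Ne.symm (mul_ne_zero hc ?_))
    simp only [w, if_pos hu]
    split_ifs <;> norm_num
  by_cases hall : ∀ i, i ∈ H
  · exact ⟨w, fun i => hpos i (hall i)⟩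
  · push Not at hall
    obtain ⟨i₀, hi₀⟩ := hall
    have hsub : ∀ i, i ∉ H → i = i₀ := by
      have hc : Hᶜ.ncard ≤ 1 := by
        have := Set.ncard_add_ncard_compl H
        omega
      exact fun i hi => (Set.ncard_le_one (Set.toFinite _)).1 hc i hi i₀ hi₀
    obtain ⟨t, ht⟩ := exists_forall_pos_mul_add (M *ᵥ w) (M *ᵥ M i₀)
    refine ⟨t • w + M i₀, fun i => ?_⟩
    rw [Matrix.mulVec_add, Matrix.mulVec_smul]
    refine ht i ?_
    by_cases hi : i ∈ H
    · exact Or.inl (hpos i hi)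
    · obtain rfl := hsub i hi
      obtain ⟨c, hc⟩ := hrows i
      exact Or.inr ⟨hnonneg i, Finset.sum_pos' (fun c _ => mul_self_nonneg _)
        ⟨c, Finset.mem_univ c, mul_self_pos.2 hc⟩⟩

lemma exists_sum_mulVec_pos_of_blockTriangular {ι κ : Type*} [Finite ι] [Fintype κ]
    (M : ℕ → Matrix ι κ ℝ) (lev : ι → ℕ) (N : ℕ)
    (hlev : ∀ i, lev i < N) (hzero : ∀ j i, j < lev i → ∀ c, M j i c = 0)
    (hpos : ∀ k, ∃ v : κ → ℝ, ∀ i, lev i = k → 0 < (M k *ᵥ v) i) :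
    ∃ u : ℕ → κ → ℝ, ∀ i, 0 < ∑ j ∈ Finset.range N, (M j *ᵥ u j) i := by
  suffices h : ∀ d ≤ N, ∃ u : ℕ → κ → ℝ, ∀ i, N ≤ lev i + d →
      0 < ∑ j ∈ Finset.range N, (M j *ᵥ u j) i by
    obtain ⟨u, hu⟩ := h N le_rfl
    exact ⟨u, fun i => hu i (by omega)⟩
  intro d
  induction d with
  | zero => exact fun _ => ⟨0, fun i hi => absurd (hlev i) (by omega)⟩
  | succ d ih =>
    intro hd
    obtain ⟨u, hu⟩ := ih (by omega)
    obtain ⟨k, hk⟩ : ∃ k, k + (d + 1) = N := ⟨N - (d + 1), by omega⟩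
    obtain ⟨v, hv⟩ := hpos k
    obtain ⟨t, ht⟩ := exists_forall_pos_mul_add (M k *ᵥ v)
      (fun i => ∑ j ∈ Finset.range N, (M j *ᵥ u j) i)
    refine ⟨u + Pi.single k (t • v), fun i hi => ?_⟩
    have hsum : ∑ j ∈ Finset.range N, (M j *ᵥ (u + Pi.single k (t • v) : ℕ → κ → ℝ) j) i =
        t * (M k *ᵥ v) i + ∑ j ∈ Finset.range N, (M j *ᵥ u j) i := by
      simp only [Pi.add_apply, Matrix.mulVec_add, Finset.sum_add_distrib]
      rw [add_comm, add_left_inj, Finset.sum_eq_single_of_mem k (Finset.mem_range.2 (by omega))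
        (fun j _ hj => by simp [Pi.single_eq_of_ne hj])]
      simp [Matrix.mulVec_smul]
    rw [hsum]
    refine ht i ?_
    rcases (show lev i = k ∨ k < lev i by omega) with h | h
    · exact Or.inl (hv i h)
    · have h0 : (M k *ᵥ v) i = 0 := by simp [Matrix.mulVec, dotProduct, hzero k i h]
      exact Or.inr ⟨h0.ge, hu i (by omega)⟩

theorem stmt3 {m K : ℕ} (ms : Fin K → ℕ) (hms : ∀ k, 0 < ms k)
    (A : Matrix (LFIdx m K ms) (LFIdx m K ms) ℝ)
    (B : Matrix (LFIdx m K ms) (Fin m) ℝ)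
    -- B = [I_m ; 0]
    (hB : B = Matrix.of fun i j => if i = Sum.inl j then 1 else 0)
    -- the rows of A^j B indexed by the block F_{k+1} are zero for every j < k+1
    (hzero : ∀ (k : Fin K) (j : ℕ), j < (k : ℕ) + 1 →
      ∀ (i : Fin (ms k)) (c : Fin m), (A ^ j * B) (Sum.inr ⟨k, i⟩) c = 0)
    -- Φ_{k+1} : the rows of A^{k+1} B indexed by the block F_{k+1}
    (Φ : ∀ k : Fin K, Matrix (Fin (ms k)) (Fin m) ℝ)
    (hΦ : ∀ (k : Fin K) (i : Fin (ms k)) (c : Fin m),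
      Φ k i c = (A ^ ((k : ℕ) + 1) * B) (Sum.inr ⟨k, i⟩) c)
    -- each Φ_k has no zero rows
    (hrows : ∀ (k : Fin K) (i : Fin (ms k)), ∃ c, Φ k i c ≠ 0)
    -- |H_k| ≥ m_k - 1 where H_k is the union of the nonzero patterns of the
    -- unisigned columns of Φ_k
    (hcard : ∀ k : Fin K, ms k - 1 ≤
      Set.ncard {i : Fin (ms k) | ∃ c, Unisigned (fun i' => Φ k i' c) ∧ Φ k i c ≠ 0}) :
    -- the pair (A,B) is herdable
    ∃ u : Fin (Fintype.card (LFIdx m K ms)) × Fin m → ℝ,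
      ∀ i, 0 < (ctrbMat A B).mulVec u i := by
  classical
  let lev : LFIdx m K ms → ℕ := Sum.elim (fun _ => 0) (fun p => (p.1 : ℕ) + 1)
  have hlev : ∀ i, lev i < Fintype.card (LFIdx m K ms) := by
    rintro (i | ⟨k, i⟩)
    · exact Fintype.card_pos_iff.2 ⟨Sum.inl i⟩
    · obtain ⟨c, -⟩ := hrows k i
      have hK : K ≤ ∑ k, ms k := by
        simpa using Finset.card_nsmul_le_sum Finset.univ ms 1 fun k _ => hms k
      have hc := c.pos
      have hk := k.isLt
      simp only [lev, Sum.elim_inr, Fintype.card_sum, Fintype.card_sigma, Fintype.card_fin]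
      omega
  obtain ⟨u, hu⟩ := exists_sum_mulVec_pos_of_blockTriangular (fun j => A ^ j * B) lev
    (Fintype.card (LFIdx m K ms)) hlev
    (by
      rintro j (i | ⟨k, i⟩) hj c
      · exact absurd hj (Nat.not_lt_zero j)
      · exact hzero k j hj i c)
    (by
      rintro (_ | k)
      · refine ⟨1, ?_⟩
        rintro (i | ⟨k, i⟩) hi
        · simp [hB, Matrix.mulVec, dotProduct]
        · simp [lev] at hi
      · by_cases hk : k < K
        · obtain ⟨v, hv⟩ := exists_mulVec_pos_of_ncard_unisigned (Φ ⟨k, hk⟩) (hrows _)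
            (by simpa using hcard ⟨k, hk⟩)
          refine ⟨v, ?_⟩
          rintro (i | ⟨l, i⟩) hi
          · simp [lev] at hi
          · obtain rfl : l = ⟨k, hk⟩ := Fin.ext (by simpa [lev] using hi)
            simpa only [Matrix.mulVec, dotProduct, hΦ] using hv i
        · refine ⟨0, ?_⟩
          rintro (i | ⟨l, i⟩) hi
          · simp [lev] at hi
          · have := l.isLt
            simp only [lev, Sum.elim_inr] at hi
            omega)
  refine ⟨fun p => u p.1 p.2, fun i => ?_⟩
  have h := hu i
  rw [← Fin.sum_univ_eq_sum_range (fun j => ((A ^ j * B) *ᵥ u j) i)] at h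
  simpa only [ctrbMat, Matrix.mulVec, dotProduct, Matrix.of_apply, Fintype.sum_prod_type] using h
end

section
/- Let A ∈ ℝ^{n×n} be block-partitioned as A = [[A₁₁, A₁₂],[A₂₁, A₂₂]] with A₁₁ ∈ ℝ^{m×m}, and let B = [I_m; 0] ∈ ℝ^{n×m}. Then for every v₁ ∈ ℝ^m and v₂ ∈ ℝ^{n−m}, the vector (v₁; v₂) belongs to Im(R(A,B)) if and only if v₂ belongs to Im(R(A₂₂, A₂₁)). Consequently, the pair (A,B) is herdable if and only if the pair (A₂₂, A₂₁) is herdable. -/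
open Matrix

theorem ctrbMat_mulVec {I : Type*} [Fintype I] [DecidableEq I] {m : ℕ}
    (A : Matrix I I ℝ) (B : Matrix I (Fin m) ℝ)
    (u : Fin (Fintype.card I) × Fin m → ℝ) :
    (ctrbMat A B).mulVec u =
      ∑ k : Fin (Fintype.card I), (A ^ (k : ℕ)) *ᵥ (B *ᵥ fun j => u (k, j)) := by
  ext i
  simp only [Finset.sum_apply, Matrix.mulVec_mulVec, ctrbMat, Matrix.mulVec, dotProduct,
    Matrix.of_apply, Fintype.sum_prod_type]

theorem pow_mulVec_mem_range_ctrbMat {I : Type*} [Fintype I] [DecidableEq I] {m : ℕ}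
    (A : Matrix I I ℝ) (B : Matrix I (Fin m) ℝ) (k : ℕ) (w : Fin m → ℝ) :
    (A ^ k) *ᵥ (B *ᵥ w) ∈ LinearMap.range (ctrbMat A B).mulVecLin := by
  have hlt : ∀ k < Fintype.card I,
      (A ^ k) *ᵥ (B *ᵥ w) ∈ LinearMap.range (ctrbMat A B).mulVecLin := by
    intro k hk
    refine ⟨fun q => if q.1 = ⟨k, hk⟩ then w q.2 else 0, ?_⟩
    rw [Matrix.mulVecLin_apply, ctrbMat_mulVec, Finset.sum_eq_single ⟨k, hk⟩]
    · simp
    · intro b _ hb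
      have h0 : (fun _ : Fin m => (0 : ℝ)) = 0 := rfl
      simp [hb, h0]
    · simp
  rw [Matrix.pow_eq_aeval_mod_charpoly, Polynomial.aeval_eq_sum_range, Matrix.sum_mulVec]
  refine Submodule.sum_mem _ fun l _ => ?_
  rw [Matrix.smul_mulVec]
  by_cases hl : l < Fintype.card I
  · exact Submodule.smul_mem _ _ (hlt l hl)
  · have hdeg : (Polynomial.X ^ k %ₘ A.charpoly).degree < (l : WithBot ℕ) := by
      refine (Polynomial.degree_modByMonic_lt _ A.charpoly_monic).trans_le ?_
      rw [Matrix.charpoly_degree_eq_dim]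
      exact_mod_cast not_lt.mp hl
    rw [Polynomial.coeff_eq_zero_of_degree_lt hdeg, zero_smul]
    exact Submodule.zero_mem _

/-- The image of the controllability matrix is the smallest `A`-invariant subspace containing
the image of `B`. -/
theorem exists_ctrbMat_mulVec_eq_iff {I : Type*} [Fintype I] [DecidableEq I] {m : ℕ}
    (A : Matrix I I ℝ) (B : Matrix I (Fin m) ℝ) (v : I → ℝ) :
    (∃ u, (ctrbMat A B).mulVec u = v) ↔
      ∀ W : Submodule ℝ (I → ℝ), (∀ w, B *ᵥ w ∈ W) → (∀ x ∈ W, A *ᵥ x ∈ W) → v ∈ W := by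
  constructor
  · rintro ⟨u, rfl⟩ W hB hA
    have hpow : ∀ (k : ℕ) (w : Fin m → ℝ), (A ^ k) *ᵥ (B *ᵥ w) ∈ W := by
      intro k w
      induction k with
      | zero => simpa using hB w
      | succ k ih =>
        rw [pow_succ', ← Matrix.mulVec_mulVec]
        exact hA _ ih
    rw [ctrbMat_mulVec]
    exact Submodule.sum_mem _ fun k _ => hpow k _
  · intro h
    refine h (LinearMap.range (ctrbMat A B).mulVecLin) (fun w => ?_) ?_
    · simpa using pow_mulVec_mem_range_ctrbMat A B 0 w
    · rintro _ ⟨u, rfl⟩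
      rw [Matrix.mulVecLin_apply, ctrbMat_mulVec, Matrix.mulVec_sum]
      refine Submodule.sum_mem _ fun k _ => ?_
      rw [Matrix.mulVec_mulVec, ← pow_succ']
      exact pow_mulVec_mem_range_ctrbMat A B _ _

theorem stmt5 {m p : ℕ}
    (A₁₁ : Matrix (Fin m) (Fin m) ℝ) (A₁₂ : Matrix (Fin m) (Fin p) ℝ)
    (A₂₁ : Matrix (Fin p) (Fin m) ℝ) (A₂₂ : Matrix (Fin p) (Fin p) ℝ)
    (A : Matrix (Fin m ⊕ Fin p) (Fin m ⊕ Fin p) ℝ)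
    (hA : A = Matrix.fromBlocks A₁₁ A₁₂ A₂₁ A₂₂)
    (B : Matrix (Fin m ⊕ Fin p) (Fin m) ℝ)
    -- B = [I_m ; 0]
    (hB : B = Matrix.of fun i j => if i = Sum.inl j then 1 else 0) :
    -- (v₁; v₂) ∈ Im(R(A,B)) iff v₂ ∈ Im(R(A₂₂,A₂₁)) ...
    (∀ (v₁ : Fin m → ℝ) (v₂ : Fin p → ℝ),
      (∃ u, (ctrbMat A B).mulVec u = Sum.elim v₁ v₂) ↔
      (∃ u, (ctrbMat A₂₂ A₂₁).mulVec u = v₂)) ∧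
    -- ... and consequently (A,B) is herdable iff (A₂₂,A₂₁) is herdable
    ((∃ u, ∀ i, 0 < (ctrbMat A B).mulVec u i) ↔
     (∃ u, ∀ i, 0 < (ctrbMat A₂₂ A₂₁).mulVec u i)) := by
  subst hA
  have hBw : ∀ w, B *ᵥ w = Sum.elim w (0 : Fin p → ℝ) := by
    intro w
    subst hB
    ext i
    rcases i with i | i <;> simp [Matrix.mulVec, dotProduct]
  have key : ∀ (v₁ : Fin m → ℝ) (v₂ : Fin p → ℝ),
      (∃ u, (ctrbMat (Matrix.fromBlocks A₁₁ A₁₂ A₂₁ A₂₂) B).mulVec u = Sum.elim v₁ v₂) ↔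
      (∃ u, (ctrbMat A₂₂ A₂₁).mulVec u = v₂) := by
    intro v₁ v₂
    rw [exists_ctrbMat_mulVec_eq_iff, exists_ctrbMat_mulVec_eq_iff]
    constructor
    · intro h W hW₁ hW₂
      refine h (W.comap (LinearMap.funLeft ℝ ℝ Sum.inr)) (fun w => ?_) fun x hx => ?_
      · rw [hBw]
        exact W.zero_mem
      · rw [Matrix.fromBlocks_mulVec]
        exact W.add_mem (hW₁ _) (hW₂ _ hx)
    · intro h W hW₁ hW₂
      simp only [hBw] at hW₁
      have hmem : v₂ ∈ W.map (LinearMap.funLeft ℝ ℝ Sum.inr) := by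
        refine h _ (fun w => ⟨_, hW₂ _ (hW₁ w), ?_⟩) ?_
        · ext i
          simp [LinearMap.funLeft_apply, Matrix.fromBlocks_mulVec]
        · rintro _ ⟨x, hx, rfl⟩
          refine ⟨_, hW₂ _ (W.sub_mem hx (hW₁ (x ∘ Sum.inl))), ?_⟩
          have hsub : x - Sum.elim (x ∘ Sum.inl) 0 =
              Sum.elim (0 : Fin m → ℝ) (x ∘ Sum.inr) := by
            ext i
            rcases i with i | i <;> simp
          rw [hsub]
          ext i
          simp only [LinearMap.funLeft_apply, Matrix.fromBlocks_mulVec, Sum.elim_inr,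
            Sum.elim_comp_inl, Sum.elim_comp_inr, Matrix.mulVec_zero, zero_add]
          rfl
      obtain ⟨x, hx, rfl⟩ := hmem
      convert W.add_mem hx (hW₁ (v₁ - x ∘ Sum.inl)) using 1
      ext i
      rcases i with i | i <;> simp [LinearMap.funLeft_apply]
  refine ⟨key, ?_, ?_⟩
  · rintro ⟨u, hu⟩
    obtain ⟨u', hu'⟩ := (key _ _).1 ⟨u, (Sum.elim_comp_inl_inr _).symm⟩
    exact ⟨u', fun i => hu' ▸ hu (Sum.inr i)⟩
  · rintro ⟨u, hu⟩
    obtain ⟨u', hu'⟩ := (key 1 _).2 ⟨u, rfl⟩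
    refine ⟨u', fun i => ?_⟩
    rw [hu']
    rcases i with i | i
    · simp
    · exact hu i
end

section
/- Let A ∈ ℝ^{n×n} be block-partitioned as A = [[A₁₁, A₁₂],[A₂₁, A₂₂]] with A₁₁ ∈ ℝ^{m×m}, and let B = [I_m; 0] ∈ ℝ^{n×m}. Then the image of the matrix [0 | I_{n−m}] · [AB | A²B | ... | A^{n−1}B] equals the image of the controllability matrix R(A₂₂, A₂₁) = [A₂₁ | A₂₂A₂₁ | ... | A₂₂^{n−m−1}A₂₁]. -/
open Matrix

/-- The span of the columns of the first `k` matrices of a sequence. -/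
def colSpan {ι κ : Type*} (F : ℕ → Matrix ι κ ℝ) (k : ℕ) : Submodule ℝ (ι → ℝ) :=
  Submodule.span ℝ {x | ∃ i < k, ∃ j, (F i).col j = x}

section ColSpan

variable {ι κ : Type*} (F G : ℕ → Matrix ι κ ℝ)

lemma col_mem_colSpan {i k : ℕ} (h : i < k) (j : κ) : (F i).col j ∈ colSpan F k :=
  Submodule.subset_span ⟨i, h, j, rfl⟩

lemma colSpan_le {k : ℕ} {S : Submodule ℝ (ι → ℝ)}
    (h : ∀ i < k, ∀ j, (F i).col j ∈ S) : colSpan F k ≤ S := by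
  refine Submodule.span_le.2 ?_
  rintro _ ⟨i, hi, j, rfl⟩
  exact h i hi j

lemma colSpan_mono {k l : ℕ} (h : k ≤ l) : colSpan F k ≤ colSpan F l :=
  colSpan_le F fun _ hi j => col_mem_colSpan F (hi.trans_le h) j

/-- Sequences that differ by a unitriangular combination have the same column spans. -/
lemma colSpan_eq_of_sub_mem (h : ∀ k j, (G k).col j - (F k).col j ∈ colSpan F k) (k : ℕ) :
    colSpan G k = colSpan F k := by
  induction k with
  | zero => simp [colSpan]
  | succ k ih =>
    apply le_antisymm
    · refine colSpan_le G fun i hi j => ?_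
      have h1 := colSpan_mono F (Nat.lt_succ_iff.1 hi |>.trans k.le_succ) (h i j)
      simpa using add_mem h1 (col_mem_colSpan F hi j)
    · refine colSpan_le F fun i hi j => ?_
      have h1 : (G i).col j - (F i).col j ∈ colSpan G (k + 1) :=
        colSpan_mono G k.le_succ (ih ▸ colSpan_mono F (Nat.lt_succ_iff.1 hi) (h i j))
      simpa using sub_mem (col_mem_colSpan G hi j) h1

lemma col_mul_mem_colSpan [Fintype κ] {i k : ℕ} (h : i < k) (X : Matrix κ κ ℝ) (j : κ) :
    (F i * X).col j ∈ colSpan F k := by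
  have : (F i * X).col j = ∑ l, X l j • (F i).col l := by
    ext a
    simp [Matrix.mul_apply, mul_comm]
  rw [this]
  exact sum_mem fun l _ => Submodule.smul_mem _ _ (col_mem_colSpan F h l)

lemma range_mulVec_eq_colSpan [Fintype κ] (k : ℕ) :
    Set.range (Matrix.of fun i (q : Fin k × κ) => F q.1 i q.2).mulVec = colSpan F k := by
  have h := Matrix.range_mulVecLin (Matrix.of fun i (q : Fin k × κ) => F q.1 i q.2)
  have h2 : Set.range (Matrix.of fun i (q : Fin k × κ) => F q.1 i q.2).col =
      {x | ∃ i < k, ∃ j, (F i).col j = x} := by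
    ext x
    constructor
    · rintro ⟨q, rfl⟩
      exact ⟨q.1, q.1.2, q.2, rfl⟩
    · rintro ⟨i, hi, j, rfl⟩
      exact ⟨(⟨i, hi⟩, j), rfl⟩
  rw [h2] at h
  exact congrArg (fun S : Submodule ℝ (ι → ℝ) => (S : Set (ι → ℝ))) h

end ColSpan

/-- By Cayley–Hamilton the column spans of `AⁱB` are stationary from `i = p` on. -/
lemma colSpan_pow_mul_eq {p : ℕ} {κ : Type*} (A : Matrix (Fin p) (Fin p) ℝ)
    (B : Matrix (Fin p) κ ℝ) {k : ℕ} (hk : p ≤ k) :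
    colSpan (fun i => A ^ i * B) k = colSpan (fun i => A ^ i * B) p := by
  rcases Nat.eq_zero_or_pos p with rfl | hp
  · exact Subsingleton.elim _ _
  refine le_antisymm (colSpan_le _ fun i _ j => ?_) (colSpan_mono _ hk)
  have hd : (Polynomial.X ^ i %ₘ A.charpoly).natDegree < p := by
    have hdeg : A.charpoly.natDegree = p := by simp
    have := Polynomial.natDegree_modByMonic_lt (Polynomial.X ^ i) A.charpoly_monic
      (fun h => by simp [h] at hdeg; omega)
    rwa [hdeg] at this
  have hpow : A ^ i = ∑ l ∈ Finset.range p, (Polynomial.X ^ i %ₘ A.charpoly).coeff l • A ^ l := by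
    rw [← Polynomial.aeval_eq_sum_range' hd, ← Matrix.pow_eq_aeval_mod_charpoly]
  have hcol : (A ^ i * B).col j = ∑ l ∈ Finset.range p,
      (Polynomial.X ^ i %ₘ A.charpoly).coeff l • (A ^ l * B).col j := by
    rw [hpow, Matrix.sum_mul]
    ext a
    simp [Matrix.sum_apply]
  change (A ^ i * B).col j ∈ _
  rw [hcol]
  exact sum_mem fun l hl => Submodule.smul_mem _ _
    (col_mem_colSpan (fun i => A ^ i * B) (Finset.mem_range.1 hl) j)

lemma toRows₂_fromBlocks_pow_mul {ι κ μ : Type*} [Fintype ι] [Fintype κ] [DecidableEq ι]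
    [DecidableEq κ] (A₁₁ : Matrix ι ι ℝ) (A₁₂ : Matrix ι κ ℝ) (A₂₁ : Matrix κ ι ℝ)
    (A₂₂ : Matrix κ κ ℝ) (B : Matrix (ι ⊕ κ) μ ℝ) (hB : B.toRows₂ = 0) (k : ℕ) :
    (fromBlocks A₁₁ A₁₂ A₂₁ A₂₂ ^ k * B).toRows₂ = ∑ i ∈ Finset.range k,
      A₂₂ ^ i * A₂₁ * (fromBlocks A₁₁ A₁₂ A₂₁ A₂₂ ^ (k - 1 - i) * B).toRows₁ := by
  induction k with
  | zero => simpa using hB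
  | succ k ih =>
    have hstep (M : Matrix (ι ⊕ κ) μ ℝ) : (fromBlocks A₁₁ A₁₂ A₂₁ A₂₂ * M).toRows₂ =
        A₂₁ * M.toRows₁ + A₂₂ * M.toRows₂ := by
      ext i j
      simp [Matrix.mul_apply, Matrix.toRows₁, Matrix.toRows₂]
    rw [pow_succ', Matrix.mul_assoc, hstep, ih, Finset.sum_range_succ', Matrix.mul_sum, add_comm]
    congr 1
    · refine Finset.sum_congr rfl fun i _ => ?_
      rw [show k + 1 - 1 - (i + 1) = k - 1 - i by omega, pow_succ']
      simp only [Matrix.mul_assoc]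
    · simp

theorem stmt6 {m p : ℕ}
    (A₁₁ : Matrix (Fin m) (Fin m) ℝ) (A₁₂ : Matrix (Fin m) (Fin p) ℝ)
    (A₂₁ : Matrix (Fin p) (Fin m) ℝ) (A₂₂ : Matrix (Fin p) (Fin p) ℝ)
    (A : Matrix (Fin m ⊕ Fin p) (Fin m ⊕ Fin p) ℝ)
    (hA : A = Matrix.fromBlocks A₁₁ A₁₂ A₂₁ A₂₂)
    (B : Matrix (Fin m ⊕ Fin p) (Fin m) ℝ)
    -- B = [I_m ; 0]
    (hB : B = Matrix.of fun i j => if i = Sum.inl j then 1 else 0)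
    -- Φ₂₂ = [0 | I_{n-m}] · [AB | A²B | ... | A^{n-1}B] (the last n-m rows)
    (Φ₂₂ : Matrix (Fin p) (Fin (m + p - 1) × Fin m) ℝ)
    (hΦ₂₂ : Φ₂₂ = Matrix.of fun i q => (A ^ ((q.1 : ℕ) + 1) * B) (Sum.inr i) q.2) :
    Set.range Φ₂₂.mulVec = Set.range (ctrbMat A₂₂ A₂₁).mulVec := by
  subst hA hB hΦ₂₂
  set A := fromBlocks A₁₁ A₁₂ A₂₁ A₂₂
  set B : Matrix (Fin m ⊕ Fin p) (Fin m) ℝ :=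
    Matrix.of fun i j => if i = Sum.inl j then 1 else 0 with hB
  have hB₁ : B.toRows₁ = 1 := by
    ext i j
    simp [hB, Matrix.toRows₁, Matrix.one_apply]
  have hB₂ : B.toRows₂ = 0 := by
    ext i j
    simp [hB, Matrix.toRows₂]
  have hsub : ∀ k j, ((A ^ (k + 1) * B).toRows₂).col j - (A₂₂ ^ k * A₂₁).col j ∈
      colSpan (fun i => A₂₂ ^ i * A₂₁) k := by
    intro k j
    have hcol : ((A ^ (k + 1) * B).toRows₂).col j - (A₂₂ ^ k * A₂₁).col j =
        ∑ i ∈ Finset.range k, (A₂₂ ^ i * A₂₁ * (A ^ (k - i) * B).toRows₁).col j := by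
      rw [toRows₂_fromBlocks_pow_mul A₁₁ A₁₂ A₂₁ A₂₂ B hB₂, Finset.sum_range_succ]
      ext a
      simp [Matrix.sum_apply, hB₁, A]
    rw [hcol]
    exact sum_mem fun i hi =>
      col_mul_mem_colSpan (fun i => A₂₂ ^ i * A₂₁) (Finset.mem_range.1 hi) _ j
  have hΦ := range_mulVec_eq_colSpan (fun k => (A ^ (k + 1) * B).toRows₂) (m + p - 1)
  have hR := range_mulVec_eq_colSpan (fun k => A₂₂ ^ k * A₂₁) (Fintype.card (Fin p))
  refine hΦ.trans (Eq.trans ?_ hR.symm)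
  rw [colSpan_eq_of_sub_mem _ _ hsub, Fintype.card_fin]
  rcases Nat.eq_zero_or_pos m with rfl | hm
  · simp [colSpan]
  · rw [colSpan_pow_mul_eq A₂₂ A₂₁ (by omega : p ≤ m + p - 1)]
end

section
/- Let A ∈ ℝ^{n×n} be block-partitioned as A = [[A₁₁, A₁₂],[A₂₁, A₂₂]] with A₁₁ ∈ ℝ^{m×m}, and let B = [I_m; 0] ∈ ℝ^{n×m}. Suppose that A₁₁ and A₂₂ are entrywise nonnegative, A₁₂ and A₂₁ are entrywise nonpositive (i.e., the directed graph G(A) is structurally balanced with classes V₁ = [1,m] and V₂ = [m+1,n]), and that the directed graph G(A) on nodes [1,n], with an arc from j to i whenever [A]_{ij} ≠ 0, is strongly connected. Then the pair (A,B) is herdable. -/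
open Matrix

/-- Gordan's alternative: if the range of a real matrix contains no strictly positive vector, then
its left kernel contains a nonzero nonnegative vector. -/
theorem exists_nonneg_vecMul_eq_zero {I J : Type*} [Fintype I] [Fintype J]
    (M : Matrix I J ℝ) (h : ¬ ∃ u : J → ℝ, ∀ i, 0 < (M *ᵥ u) i) :
    ∃ v : I → ℝ, (∀ i, 0 ≤ v i) ∧ (∃ i, 0 < v i) ∧ v ᵥ* M = 0 := by
  classical
  have hdisj : Disjoint (Set.univ.pi fun _ : I => Set.Ioi (0 : ℝ))
      (LinearMap.range M.mulVecLin : Set (I → ℝ)) := by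
    rw [Set.disjoint_left]
    rintro _ hx ⟨u, rfl⟩
    exact h ⟨u, fun i => by simpa using hx i trivial⟩
  obtain ⟨f, c, hf, hc⟩ := geometric_hahn_banach_open
    (convex_pi fun _ _ => convex_Ioi (0 : ℝ))
    (isOpen_set_pi Set.finite_univ fun _ _ => isOpen_Ioi)
    (LinearMap.range M.mulVecLin).convex hdisj
  have hc0 : c ≤ 0 := by simpa using hc 0 (Submodule.zero_mem _)
  have hneg : ∀ x : I → ℝ, (∀ i, 0 < x i) → f x < 0 := fun x hx =>
    (hf x fun i _ => hx i).trans_le hc0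
  have hzero : ∀ u : J → ℝ, f (M *ᵥ u) = 0 := by
    intro u
    by_contra hne
    have := hc (M *ᵥ (((c - 1) / f (M *ᵥ u)) • u)) ⟨_, rfl⟩
    rw [Matrix.mulVec_smul, map_smul, smul_eq_mul, div_mul_cancel₀ _ hne] at this
    linarith
  have hsum : ∀ x : I → ℝ, f x = ∑ i, x i * f (Pi.single i 1) := by
    intro x
    conv_lhs => rw [pi_eq_sum_univ' x]
    simp [map_sum]
  have hone : f 1 < 0 := hneg 1 fun _ => one_pos
  have hle : ∀ i, f (Pi.single i 1) ≤ 0 := by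
    intro i
    by_contra! hpos
    have := hneg (1 + (-f 1 / f (Pi.single i 1)) • Pi.single i 1) fun j => by
      have h1 : 0 ≤ -f 1 / f (Pi.single i 1) := div_nonneg (by linarith) hpos.le
      by_cases hij : j = i
      · subst hij
        simpa using by linarith
      · simp [hij]
    rw [map_add, map_smul, smul_eq_mul, div_mul_cancel₀ _ hpos.ne'] at this
    linarith
  refine ⟨fun i => -f (Pi.single i 1), fun i => neg_nonneg.2 (hle i), ?_, ?_⟩
  · by_contra! hnonpos
    have : f 1 = 0 := by
      rw [hsum]
      exact Finset.sum_eq_zero fun i _ => by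
        rw [le_antisymm (hle i) (by linarith [hnonpos i]), mul_zero]
    exact hone.ne this
  · ext j
    have := hzero (Pi.single j 1)
    rw [hsum] at this
    simp only [Matrix.mulVec_single_one, Matrix.col_apply] at this
    simp only [Matrix.vecMul, dotProduct, Pi.zero_apply, neg_mul, Finset.sum_neg_distrib, neg_eq_zero]
    rw [← this]
    exact Finset.sum_congr rfl fun i _ => mul_comm _ _

/-- A vector in the left kernel of the controllability matrix annihilates `A ^ k * B` for every
`k`. -/
theorem vecMul_pow_mul_eq_zero_of_vecMul_ctrbMat {I : Type*} [Fintype I] [DecidableEq I] {m : ℕ}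
    {A : Matrix I I ℝ} {B : Matrix I (Fin m) ℝ} {v : I → ℝ} (hv : v ᵥ* ctrbMat A B = 0) (k : ℕ) :
    v ᵥ* (A ^ k * B) = 0 := by
  have hlt : ∀ k < Fintype.card I, v ᵥ* (A ^ k * B) = 0 := fun k hk =>
    funext fun j => congrFun hv (⟨k, hk⟩, j)
  cases isEmpty_or_nonempty I with
  | inl hI =>
    ext j
    simp [Matrix.vecMul, dotProduct]
  | inr hI =>
    have hdeg : (Polynomial.X ^ k %ₘ A.charpoly).natDegree < Fintype.card I := by
      rw [← A.charpoly_natDegree_eq_dim]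
      refine Polynomial.natDegree_modByMonic_lt _ A.charpoly_monic fun h => ?_
      have := A.charpoly_natDegree_eq_dim
      rw [h, Polynomial.natDegree_one] at this
      exact Fintype.card_ne_zero this.symm
    rw [Matrix.pow_eq_aeval_mod_charpoly, Polynomial.aeval_eq_sum_range' hdeg, Matrix.sum_mul,
      Matrix.vecMul_sum]
    refine Finset.sum_eq_zero fun i hi => ?_
    rw [Matrix.smul_mul, Matrix.vecMul_smul, hlt i (Finset.mem_range.1 hi), smul_zero]

theorem stmt9 {m p : ℕ} (hm : 0 < m)
    (A₁₁ : Matrix (Fin m) (Fin m) ℝ) (A₁₂ : Matrix (Fin m) (Fin p) ℝ)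
    (A₂₁ : Matrix (Fin p) (Fin m) ℝ) (A₂₂ : Matrix (Fin p) (Fin p) ℝ)
    (A : Matrix (Fin m ⊕ Fin p) (Fin m ⊕ Fin p) ℝ)
    (hA : A = Matrix.fromBlocks A₁₁ A₁₂ A₂₁ A₂₂)
    (B : Matrix (Fin m ⊕ Fin p) (Fin m) ℝ)
    -- B = [I_m ; 0]
    (hB : B = Matrix.of fun i j => if i = Sum.inl j then 1 else 0)
    -- structural balance: diagonal blocks nonnegative, off-diagonal blocks nonpositive
    (h11 : ∀ i j, 0 ≤ A₁₁ i j) (h22 : ∀ i j, 0 ≤ A₂₂ i j)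
    (h12 : ∀ i j, A₁₂ i j ≤ 0) (h21 : ∀ i j, A₂₁ i j ≤ 0)
    -- G(A) (arc from j to i iff [A]_{ij} ≠ 0) is strongly connected
    (hconn : ∀ i j : Fin m ⊕ Fin p,
      Relation.ReflTransGen (fun a b => A b a ≠ 0) i j) :
    -- the pair (A,B) is herdable
    ∃ u : Fin (Fintype.card (Fin m ⊕ Fin p)) × Fin m → ℝ,
      ∀ i, 0 < (ctrbMat A B).mulVec u i := by
  classical
  by_contra hnot
  obtain ⟨v, hv0, ⟨a, ha⟩, hv⟩ := exists_nonneg_vecMul_eq_zero _ hnot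
  have hinl : ∀ w : Fin m ⊕ Fin p → ℝ, (∀ k, w ᵥ* (A ^ k * B) = 0) → ∀ j, w (Sum.inl j) = 0 := by
    intro w hw j
    have := congrFun (hw 0) j
    simpa [hB, Matrix.vecMul, dotProduct] using this
  have hback : ∀ b, Relation.ReflTransGen (fun a b => A b a ≠ 0) b a →
      ∃ w : Fin m ⊕ Fin p → ℝ, (∀ i, 0 ≤ w i) ∧ (∀ k, w ᵥ* (A ^ k * B) = 0) ∧ 0 < w b := by
    intro b hb
    induction hb using Relation.ReflTransGen.head_induction_on with
    | refl => exact ⟨v, hv0, vecMul_pow_mul_eq_zero_of_vecMul_ctrbMat hv, ha⟩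
    | @head c b hcb _ ih =>
      obtain ⟨w, hw0, hw, hwb⟩ := ih
      have hwA : ∀ k, (w ᵥ* A) ᵥ* (A ^ k * B) = 0 := fun k => by
        rw [Matrix.vecMul_vecMul, ← Matrix.mul_assoc, ← pow_succ', hw]
      have hsum : ∀ j, (w ᵥ* A) j = ∑ i, w i * A i j := fun j => by
        simp [Matrix.vecMul, dotProduct]
      have hterm : ∀ i j, 0 ≤ w i * A i (Sum.inr j) := by
        rintro (i | i) j
        · simp [hinl w hw]
        · exact mul_nonneg (hw0 _) (by simpa [hA] using h22 i j)
      refine ⟨w ᵥ* A, ?_, hwA, ?_⟩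
      · rintro (j | j)
        · exact (hinl _ hwA j).ge
        · exact hsum _ ▸ Finset.sum_nonneg fun i _ => hterm i j
      · rcases c with j | j
        · have hterm' : ∀ i, w i * A i (Sum.inl j) ≤ 0 := by
            rintro (i | i)
            · simp [hinl w hw]
            · exact mul_nonpos_of_nonneg_of_nonpos (hw0 _) (by simpa [hA] using h21 i j)
          have hz := (Finset.sum_eq_zero_iff_of_nonpos fun i _ => hterm' i).1
            (hsum _ ▸ hinl _ hwA j) b (Finset.mem_univ _)
          exact absurd hz (mul_ne_zero hwb.ne' hcb)
        · exact hsum _ ▸ Finset.sum_pos' (fun i _ => hterm i j) ⟨b, Finset.mem_univ _,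
            (hterm b j).lt_of_ne' (mul_ne_zero hwb.ne' hcb)⟩
  obtain ⟨w, -, hw, hpos⟩ := hback (Sum.inl ⟨0, hm⟩) (hconn _ _)
  exact hpos.ne' (hinl w hw _)
end
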